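/- Let β ≠ 0, γ ≠ 0 and let α, η, φ, P11 be real numbers, with T = !![-η/γ, 0; φ, -α/β] and N = !![0, 0; 0, -2P11]. If C(T,N) is positive semidefinite, then det T = 1; in particular T is invertible and symplectic (T·Ω·Tᵀ = Ω). Hence no completely positive Gaussian channel of form J_II is singular. -/

import Mathlib

open Matrix Complex
open scoped ComplexOrder

/-- The one-mode symplectic form `Ω = !![0, 1; -1, 0]`. -/
noncomputable def Omega : Matrix (Fin 2) (Fin 2) ℝ := !![0, 1; -1, 0]

/-- The complete-positivity matrix `C(T,N) = N + i·Ω − i·T·Ω·Tᵀ`, real matrices viewed as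
complex via the canonical embedding. -/
noncomputable def Cmat (T N : Matrix (Fin 2) (Fin 2) ℝ) : Matrix (Fin 2) (Fin 2) ℂ :=
  N.map (fun x => (x : ℂ)) + Complex.I • (Omega.map (fun x => (x : ℂ)))
    - Complex.I • ((T * Omega * Tᵀ).map (fun x => (x : ℂ)))


theorem mul_Omega_mul_transpose (T : Matrix (Fin 2) (Fin 2) ℝ) :
    T * Omega * Tᵀ = T.det • Omega := by
  ext i j
  fin_cases i <;> fin_cases j <;>
    simp [Omega, Matrix.mul_apply, Fin.sum_univ_two, Matrix.det_fin_two] <;> ring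

theorem det_Cmat (T N : Matrix (Fin 2) (Fin 2) ℝ) (hN : N.IsSymm) :
    (Cmat T N).det = ((N.det - (1 - T.det) ^ 2 : ℝ) : ℂ) := by
  have h : N 1 0 = N 0 1 := hN.apply 0 1
  rw [Cmat, mul_Omega_mul_transpose, Matrix.det_fin_two (Matrix.map N _ + _ - _)]
  simp only [Omega, Matrix.det_fin_two N, Matrix.sub_apply, Matrix.add_apply,
    Matrix.smul_apply, Matrix.map_apply, smul_eq_mul, h]
  simp
  linear_combination ((1 : ℂ) - T.det) ^ 2 * Complex.I_sq

theorem det_eq_one_of_posSemidef_Cmat {T N : Matrix (Fin 2) (Fin 2) ℝ} (hN : N.IsSymm)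
    (hdet : N.det = 0) (hC : (Cmat T N).PosSemidef) : T.det = 1 := by
  have h := hC.det_nonneg
  rw [det_Cmat T N hN, Complex.zero_le_real, hdet] at h
  nlinarith [sq_nonneg (1 - T.det)]

/-- For `β ≠ 0`, `γ ≠ 0`, with `T = !![-η/γ, 0; φ, -α/β]` and `N = !![0, 0; 0, -2P11]`:
if `C(T,N)` is positive semidefinite then `det T = 1`; in particular `T` is invertible
and symplectic. Hence no completely positive Gaussian channel of form `J_II` is singular. -/
theorem stmt_14 (β γ α η φ P11 : ℝ) (hβ : β ≠ 0) (hγ : γ ≠ 0)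
    (hCP : (Cmat (!![-η / γ, 0; φ, -α / β]) (!![0, 0; 0, -2 * P11])).PosSemidef) :
    (!![-η / γ, 0; φ, -α / β] : Matrix (Fin 2) (Fin 2) ℝ).det = 1 ∧
      IsUnit (!![-η / γ, 0; φ, -α / β] : Matrix (Fin 2) (Fin 2) ℝ) ∧
      (!![-η / γ, 0; φ, -α / β] : Matrix (Fin 2) (Fin 2) ℝ) * Omega *
          (!![-η / γ, 0; φ, -α / β] : Matrix (Fin 2) (Fin 2) ℝ)ᵀ = Omega := by
  have hdet := det_eq_one_of_posSemidef_Cmat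
    (by ext i j; fin_cases i <;> fin_cases j <;> rfl) (by simp) hCP
  refine ⟨hdet, (Matrix.isUnit_iff_isUnit_det _).2 (hdet ▸ isUnit_one), ?_⟩
  rw [mul_Omega_mul_transpose, hdet, one_smul]
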